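/- Let S and A be finite nonempty sets, let P : S × A → (probability mass functions on S) be a transition kernel, and let τ = (s_0,a_0),…,(s_{T−1},a_{T−1}) be a path with P(s_{t+1} | s_t, a_t) > 0 for all t = 0,…,T−2. For each t = 0,…,T−2 let (G_{s,t})_{s∈S} be a family of independent standard Gumbel random variables, with all families mutually independent across t, and let E_τ be the intersection over t = 0,…,T−2 of the events E_t = {for all s in the support of P(· | s_t,a_t) with s ≠ s_{t+1}, log P(s_{t+1}|s_t,a_t) + G_{s_{t+1},t} > log P(s|s_t,a_t) + G_{s,t}}. Fix t ≤ T−2 and (s',a') ∈ S × A such that the supports of P(· | s',a') and P(· | s_t,a_t) are disjoint. Then for every s'' in the support of P(· | s',a'), P({for all s in the support of P(· | s',a') with s ≠ s'', log P(s''|s',a') + G_{s'',t} > log P(s|s',a') + G_{s,t}} | E_τ) = P(s'' | s',a'); that is, the counterfactual transition distribution at (s',a') and time t, given the observed path τ, is identical to the original (interventional) transition distribution P(· | s',a'). -/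

import Mathlib

open MeasureTheory ProbabilityTheory

/-- The probability integral transform of the Gumbel distribution is uniform on `[0,1]`. -/
lemma gumbel_map_uniform {Ω : Type*} [MeasurableSpace Ω] (μ : Measure Ω) [IsProbabilityMeasure μ]
    (X : Ω → ℝ) (hX : Measurable X)
    (hG : ∀ r, μ {ω | X ω ≤ r} = ENNReal.ofReal (Real.exp (-Real.exp (-r)))) :
    μ.map (fun ω => Real.exp (-Real.exp (-X ω))) = volume.restrict (Set.Icc (0:ℝ) 1) := by
  have hm : Measurable (fun ω => Real.exp (-Real.exp (-X ω))) := by fun_prop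
  have : IsProbabilityMeasure (μ.map (fun ω => Real.exp (-Real.exp (-X ω)))) :=
    Measure.isProbabilityMeasure_map hm.aemeasurable
  refine Measure.ext_of_Iic _ _ fun r => ?_
  rw [Measure.map_apply hm measurableSet_Iic, Measure.restrict_apply measurableSet_Iic]
  rcases le_or_gt r 0 with hr | hr
  · have h1 : (fun ω => Real.exp (-Real.exp (-X ω))) ⁻¹' Set.Iic r = ∅ := by
      ext ω
      simp only [Set.mem_preimage, Set.mem_Iic, Set.mem_empty_iff_false, iff_false, not_le]
      exact lt_of_le_of_lt hr (Real.exp_pos _)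
    have h2 : Set.Iic r ∩ Set.Icc (0:ℝ) 1 ⊆ {0} := by
      rintro x ⟨h, h', -⟩
      exact le_antisymm (le_trans h hr) h'
    rw [h1, measure_empty]
    exact (measure_mono_null h2 (by simp)).symm
  rcases le_or_gt 1 r with hr1 | hr1
  · have h1 : (fun ω => Real.exp (-Real.exp (-X ω))) ⁻¹' Set.Iic r = Set.univ := by
      ext ω
      simp only [Set.mem_preimage, Set.mem_Iic, Set.mem_univ, iff_true]
      refine le_trans ?_ hr1
      rw [Real.exp_le_one_iff]
      linarith [Real.exp_pos (-X ω)]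
    have h2 : Set.Iic r ∩ Set.Icc (0:ℝ) 1 = Set.Icc 0 1 := by
      apply Set.inter_eq_right.2
      intro x hx
      exact le_trans hx.2 hr1
    rw [h1, h2, measure_univ]
    simp
  · have hl : 0 < -Real.log r := by linarith [Real.log_neg hr hr1]
    have h1 : (fun ω => Real.exp (-Real.exp (-X ω))) ⁻¹' Set.Iic r
        = {ω | X ω ≤ -Real.log (-Real.log r)} := by
      ext ω
      simp only [Set.mem_preimage, Set.mem_Iic, Set.mem_ofPred_eq]
      rw [← Real.le_log_iff_exp_le hr, neg_le, ← Real.log_le_iff_le_exp hl]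
      constructor <;> intro h <;> linarith
    have h2 : Set.Iic r ∩ Set.Icc (0:ℝ) 1 = Set.Icc 0 r := by
      ext x
      simp only [Set.mem_inter_iff, Set.mem_Iic, Set.mem_Icc]
      constructor
      · rintro ⟨h, h', -⟩; exact ⟨h', h⟩
      · rintro ⟨h, h'⟩; exact ⟨h', h, by linarith⟩
    rw [h1, h2, hG, neg_neg, Real.exp_log hl, neg_neg, Real.exp_log hr]
    simp

/-- The Gumbel-max trick. -/
lemma gumbel_max {Ω : Type*} [MeasurableSpace Ω] (μ : Measure Ω) [IsProbabilityMeasure μ]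
    {S : Type*} [Fintype S] (p : S → ℝ) (hp0 : ∀ x, 0 ≤ p x) (hp1 : ∑ x, p x = 1)
    (X : S → Ω → ℝ) (hX : ∀ x, Measurable (X x)) (hind : iIndepFun X μ)
    (hG : ∀ x r, μ {ω | X x ω ≤ r} = ENNReal.ofReal (Real.exp (-Real.exp (-r))))
    (k : S) (hk : 0 < p k) :
    μ {ω | ∀ x, 0 < p x → x ≠ k → Real.log (p x) + X x ω < Real.log (p k) + X k ω}
      = ENNReal.ofReal (p k) := by
  classical
  set U : S → Ω → ℝ := fun x ω => Real.exp (-Real.exp (-X x ω)) with hU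
  have hUm : ∀ x, Measurable (U x) := fun x => by
    have := hX x
    simp only [hU]; fun_prop
  have hUlaw : ∀ x, μ.map (U x) = volume.restrict (Set.Icc (0:ℝ) 1) := fun x =>
    gumbel_map_uniform μ (X x) (hX x) (hG x)
  have hUind : iIndepFun U μ :=
    hind.comp (fun _ g => Real.exp (-Real.exp (-g))) (fun _ => by fun_prop)
  set F : Finset S := Finset.univ.filter (fun x => 0 < p x ∧ x ≠ k) with hF
  have hind2 : IndepFun (U k) (fun ω (x : F) => U x ω) μ := by
    have h := hUind.indepFun_finset {k} F (by simp [hF]) hUm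
    exact h.comp (φ := fun v : ({k} : Finset S) → ℝ => v ⟨k, by simp⟩) (ψ := id)
      (by fun_prop) measurable_id
  have hWm : Measurable (fun ω (x : F) => U x ω) := measurable_pi_lambda _ fun x => hUm x
  set B : Set (ℝ × (F → ℝ)) := {z | ∀ x : F, z.2 x < z.1 ^ (p x / p k)} with hB
  have hBm : MeasurableSet B := by
    have : B = ⋂ x : F, {z | z.2 x < z.1 ^ (p x / p k)} := by ext; simp [hB]
    rw [this]
    exact MeasurableSet.iInter fun x => measurableSet_lt (by fun_prop) (by fun_prop)
  have hset : {ω | ∀ x, 0 < p x → x ≠ k → Real.log (p x) + X x ω < Real.log (p k) + X k ω}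
      = (fun ω => (U k ω, fun x : F => U x ω)) ⁻¹' B := by
    ext ω
    have key : ∀ x, 0 < p x → (Real.log (p x) + X x ω < Real.log (p k) + X k ω ↔
        U x ω < U k ω ^ (p x / p k)) := by
      intro x hx
      have e : p x / p k = Real.exp (Real.log (p x) - Real.log (p k)) := by
        rw [Real.exp_sub, Real.exp_log hx, Real.exp_log hk]
      simp only [hU]
      rw [← Real.exp_mul, Real.exp_lt_exp, e, neg_mul, neg_lt_neg_iff, ← Real.exp_add,
        Real.exp_lt_exp]
      constructor <;> intro h <;> linarith
    simp only [Set.mem_ofPred_eq, Set.mem_preimage, hB, Subtype.forall, hF, Finset.mem_filter,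
      Finset.mem_univ, true_and]
    constructor
    · rintro h x ⟨hx, hxk⟩
      exact (key x hx).1 (h x hx hxk)
    · intro h x hx hxk
      exact (key x hx).2 (h x ⟨hx, hxk⟩)
  have hsum : ∑ x ∈ F, p x / p k = (1 - p k) / p k := by
    rw [← Finset.sum_div]
    congr 1
    have h1 : ∑ x ∈ F, p x = ∑ x ∈ Finset.univ.erase k, p x := by
      apply Finset.sum_subset
      · intro x hx
        simp only [hF, Finset.mem_filter] at hx
        simp [hx.2.2]
      · intro x hx hxF
        simp only [hF, Finset.mem_filter, Finset.mem_univ, true_and, not_and_or, not_lt,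
          not_not] at hxF
        have hxk := Finset.ne_of_mem_erase hx
        exact le_antisymm (hxF.resolve_right hxk) (hp0 x)
    rw [h1, ← hp1, ← Finset.add_sum_erase _ p (Finset.mem_univ k)]
    ring
  have hpk1 : p k ≤ 1 := hp1 ▸ Finset.single_le_sum (fun x _ => hp0 x) (Finset.mem_univ k)
  have hc0 : 0 ≤ (1 - p k) / p k := div_nonneg (by linarith) hk.le
  rw [hset, ← Measure.map_apply ((hUm k).prodMk hWm) hBm,
    hind2.map_prod_eq_prod_map_map (hUm k).aemeasurable hWm.aemeasurable,
    Measure.prod_apply hBm, hUlaw k]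
  have hsec : ∀ v ∈ Set.Icc (0:ℝ) 1, (μ.map (fun ω (x : F) => U x ω)) (Prod.mk v ⁻¹' B)
      = ENNReal.ofReal (v ^ ((1 - p k) / p k)) := by
    intro v hv
    rw [Measure.map_apply hWm (measurable_prodMk_left hBm)]
    have h1 : (fun ω (x : F) => U x ω) ⁻¹' (Prod.mk v ⁻¹' B)
        = ⋂ x ∈ F, U x ⁻¹' Set.Iio (v ^ (p x / p k)) := by
      ext ω; simp [hB]
    rw [h1, hUind.measure_inter_preimage_eq_mul F (fun _ _ => measurableSet_Iio), ← hsum,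
      Real.rpow_sum_of_nonneg hv.1 (fun x _ => div_nonneg (hp0 x) hk.le),
      ENNReal.ofReal_prod_of_nonneg (fun x _ => Real.rpow_nonneg hv.1 _)]
    refine Finset.prod_congr rfl fun x _ => ?_
    rw [← Measure.map_apply (hUm x) measurableSet_Iio, hUlaw x,
      Measure.restrict_apply measurableSet_Iio]
    have hle : v ^ (p x / p k) ≤ 1 :=
      Real.rpow_le_one hv.1 hv.2 (div_nonneg (hp0 x) hk.le)
    have h2 : Set.Iio (v ^ (p x / p k)) ∩ Set.Icc (0:ℝ) 1 = Set.Ico 0 (v ^ (p x / p k)) := by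
      ext y
      simp only [Set.mem_inter_iff, Set.mem_Iio, Set.mem_Icc, Set.mem_Ico]
      constructor
      · rintro ⟨h, h', -⟩; exact ⟨h', h⟩
      · rintro ⟨h, h'⟩; exact ⟨h', h, by linarith⟩
    rw [h2]
    simp
  rw [setLIntegral_congr_fun measurableSet_Icc hsec]
  have hint : IntervalIntegrable (fun v : ℝ => v ^ ((1 - p k) / p k)) volume 0 1 :=
    intervalIntegral.intervalIntegrable_rpow' (by linarith)
  have hI : IntegrableOn (fun v : ℝ => v ^ ((1 - p k) / p k)) (Set.Icc 0 1) volume := by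
    rw [integrableOn_Icc_iff_integrableOn_Ioc]
    exact (intervalIntegrable_iff_integrableOn_Ioc_of_le zero_le_one).1 hint
  rw [← ofReal_integral_eq_lintegral_ofReal hI]
  · rw [integral_Icc_eq_integral_Ioc, ← intervalIntegral.integral_of_le zero_le_one,
      integral_rpow (Or.inl (by linarith)), Real.one_rpow, Real.zero_rpow (by linarith)]
    congr 1
    field_simp
    ring
  · filter_upwards [ae_restrict_mem measurableSet_Icc] with v hv
    exact Real.rpow_nonneg hv.1 _

/-- Let `P : S × A → PMF(S)` be a transition kernel on finite nonempty
state/action spaces, and let `τ = (s 0, a 0), …, (s (T-1), a (T-1))` be a path with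
`P (s t) (a t) (s (t+1)) > 0` for `t = 0, …, T-2`. Let `(G t x)_{x ∈ S}`, for
`t = 0, …, T-2`, be mutually independent standard Gumbel random variables, and let `Eτ` be
the intersection over `t` of the events that `s (t+1)` is the Gumbel-max argmax of
`log (P (s t) (a t) x) + G t x` over the support of `P (s t) (a t)`. Fix `t` and
`(s', a')` such that the supports of `P s' a'` and `P (s t) (a t)` are disjoint. Then for
every `s''` in the support of `P s' a'`, the conditional probability given `Eτ` that `s''`
is the argmax of `log (P s' a' x) + G t x` over the support of `P s' a'` equals
`P s' a' s''`: the counterfactual transition distribution at `(s', a')` and time `t` is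
identical to the interventional one. -/
theorem counterfactual_transition_eq_interventional_of_disjoint_support
    {Ω : Type*} [MeasurableSpace Ω] (μ : Measure Ω) [IsProbabilityMeasure μ]
    {S A : Type*} [Fintype S] [Nonempty S] [Fintype A] [Nonempty A]
    (P : S → A → S → ℝ)
    (hP0 : ∀ s a s', 0 ≤ P s a s') (hP1 : ∀ s a, ∑ s' : S, P s a s' = 1)
    (T : ℕ) (s : ℕ → S) (a : ℕ → A)
    (hpath : ∀ t : Fin (T - 1), 0 < P (s t) (a t) (s ((t : ℕ) + 1)))
    (G : Fin (T - 1) → S → Ω → ℝ)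
    (hGmeas : ∀ t x, Measurable (G t x))
    (hGindep : iIndepFun (m := fun _ => Real.measurableSpace)
      (fun q : Fin (T - 1) × S => G q.1 q.2) μ)
    (hGumbel : ∀ t x r, μ {ω | G t x ω ≤ r} = ENNReal.ofReal (Real.exp (-Real.exp (-r))))
    (t : Fin (T - 1)) (s' : S) (a' : A)
    (hdisj : ∀ x : S, ¬ (0 < P s' a' x ∧ 0 < P (s t) (a t) x))
    (s'' : S) (hs'' : 0 < P s' a' s'') :
    μ[{ω | ∀ x : S, 0 < P s' a' x → x ≠ s'' →
          Real.log (P s' a' x) + G t x ω < Real.log (P s' a' s'') + G t s'' ω} |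
        ⋂ u : Fin (T - 1), {ω | ∀ x : S, 0 < P (s u) (a u) x → x ≠ s ((u : ℕ) + 1) →
          Real.log (P (s u) (a u) x) + G u x ω
            < Real.log (P (s u) (a u) (s ((u : ℕ) + 1))) + G u (s ((u : ℕ) + 1)) ω}]
      = ENNReal.ofReal (P s' a' s'') := by
  classical
  have hFprob := gumbel_max μ (P s' a') (hP0 s' a') (hP1 s' a') (G t) (hGmeas t)
    (hGindep.precomp (g := fun x : S => (t, x)) (fun x y h => (Prod.mk.inj h).2))
    (hGumbel t) s'' hs''
  set E : Set Ω := ⋂ u : Fin (T - 1), {ω | ∀ x : S, 0 < P (s u) (a u) x →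
    x ≠ s ((u : ℕ) + 1) → Real.log (P (s u) (a u) x) + G u x ω
      < Real.log (P (s u) (a u) (s ((u : ℕ) + 1))) + G u (s ((u : ℕ) + 1)) ω} with hE
  set D : Set Ω := {ω | ∀ x : S, 0 < P s' a' x → x ≠ s'' →
          Real.log (P s' a' x) + G t x ω < Real.log (P s' a' s'') + G t s'' ω} with hD
  -- positivity of the conditioning event
  have hEpos : μ E ≠ 0 := by
    let I : Fin (T - 1) × S → Set ℝ := fun q =>
      if q.2 = s ((q.1 : ℕ) + 1) then
        Set.Ioi (-Real.log (P (s q.1) (a q.1) (s ((q.1 : ℕ) + 1)))) else Set.Iic 0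
    have hIm : ∀ q, MeasurableSet (I q) := by
      intro q
      simp only [I]
      split_ifs
      · exact measurableSet_Ioi
      · exact measurableSet_Iic
    have hle : ∀ x y z, P x y z ≤ 1 := fun x y z =>
      hP1 x y ▸ Finset.single_le_sum (fun w _ => hP0 x y w) (Finset.mem_univ z)
    have hsub : (⋂ q ∈ (Finset.univ : Finset (Fin (T - 1) × S)), (G q.1 q.2) ⁻¹' I q) ⊆ E := by
      intro ω hω
      simp only [Finset.mem_univ, Set.iInter_true, Set.mem_iInter, Set.mem_preimage] at hω
      rw [hE]
      simp only [Set.mem_iInter, Set.mem_ofPred_eq]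
      intro u x hx hxne
      have h1 := hω (u, x)
      have h2 := hω (u, s ((u : ℕ) + 1))
      simp only [I, if_neg hxne, Set.mem_Iic] at h1
      simp only [I, if_true, Set.mem_Ioi] at h2
      have h3 := Real.log_nonpos hx.le (hle _ _ _)
      linarith
    refine fun h0 => absurd (measure_mono_null hsub h0) ?_
    rw [hGindep.measure_inter_preimage_eq_mul Finset.univ (fun q _ => hIm q)]
    refine Finset.prod_ne_zero_iff.2 ?_
    rintro q -
    simp only [I]
    split_ifs
    · set c := -Real.log (P (s q.1) (a q.1) (s ((q.1 : ℕ) + 1)))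
      have hc : (G q.1 q.2) ⁻¹' Set.Ioi c = {ω | G q.1 q.2 ω ≤ c}ᶜ := by
        ext ω; simp
      rw [hc, prob_compl_eq_one_sub (measurableSet_le (hGmeas _ _) measurable_const), hGumbel]
      have : ENNReal.ofReal (Real.exp (-Real.exp (-c))) < 1 := by
        rw [ENNReal.ofReal_lt_one, Real.exp_lt_one_iff]
        linarith [Real.exp_pos (-c)]
      exact (tsub_pos_of_lt this).ne'
    · have hc : (G q.1 q.2) ⁻¹' Set.Iic 0 = {ω | G q.1 q.2 ω ≤ 0} := rfl
      rw [hc, hGumbel]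
      exact (ENNReal.ofReal_pos.2 (Real.exp_pos _)).ne'
  have hEm : MeasurableSet E := by
    rw [hE]
    refine MeasurableSet.iInter fun u => ?_
    simp only [Set.ofPred_forall]
    refine MeasurableSet.iInter fun x => MeasurableSet.iInter fun _ =>
      MeasurableSet.iInter fun _ => measurableSet_lt ?_ ?_
    · exact (hGmeas _ _).const_add _
    · exact (hGmeas _ _).const_add _
  -- independence
  have hindep : μ (E ∩ D) = μ E * μ D := by
    set F1 : Finset (Fin (T - 1) × S) :=
      Finset.univ.filter (fun q => 0 < P (s q.1) (a q.1) q.2) with hF1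
    set F2 : Finset (Fin (T - 1) × S) :=
      Finset.univ.filter (fun q => q.1 = t ∧ 0 < P s' a' q.2) with hF2
    have hdis : Disjoint F1 F2 := by
      rw [Finset.disjoint_left]
      rintro ⟨u, x⟩ h1 h2
      simp only [hF1, hF2, Finset.mem_filter, Finset.mem_univ, true_and] at h1 h2
      obtain ⟨rfl, h2⟩ := h2
      exact hdisj x ⟨h2, h1⟩
    have hI := hGindep.indepFun_finset F1 F2 hdis (fun q => hGmeas q.1 q.2)
    have hm1 : ∀ (u : Fin (T - 1)) (x : S), 0 < P (s u) (a u) x → ((u, x) : Fin (T - 1) × S) ∈ F1 := by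
      intro u x h; simp [hF1, h]
    have hm2 : ∀ x, 0 < P s' a' x → ((t, x) : Fin (T - 1) × S) ∈ F2 := by
      intro x h; simp [hF2, h]
    let B1 : Set (F1 → ℝ) := {w | ∀ (u : Fin (T - 1)) (x : S), ∀ hx : 0 < P (s u) (a u) x, x ≠ s ((u : ℕ) + 1) →
      Real.log (P (s u) (a u) x) + w ⟨(u, x), hm1 u x hx⟩
      < Real.log (P (s u) (a u) (s ((u : ℕ) + 1))) +
        w ⟨(u, s ((u : ℕ) + 1)), hm1 u _ (hpath u)⟩}
    let B2 : Set (F2 → ℝ) := {w | ∀ x, ∀ hx : 0 < P s' a' x, x ≠ s'' →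
      Real.log (P s' a' x) + w ⟨(t, x), hm2 x hx⟩
      < Real.log (P s' a' s'') + w ⟨(t, s''), hm2 s'' hs''⟩}
    have hB1 : MeasurableSet B1 := by
      simp only [B1, Set.ofPred_forall]
      refine MeasurableSet.iInter fun u => MeasurableSet.iInter fun x =>
        MeasurableSet.iInter fun _ =>
        MeasurableSet.iInter fun _ => measurableSet_lt ?_ ?_
      · exact (measurable_pi_apply _).const_add _
      · exact (measurable_pi_apply _).const_add _
    have hB2 : MeasurableSet B2 := by
      simp only [B2, Set.ofPred_forall]
      refine MeasurableSet.iInter fun x =>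
        MeasurableSet.iInter fun _ =>
        MeasurableSet.iInter fun _ => measurableSet_lt ?_ ?_
      · exact (measurable_pi_apply _).const_add _
      · exact (measurable_pi_apply _).const_add _
    have hE' : E = (fun ω (q : F1) => G q.1.1 q.1.2 ω) ⁻¹' B1 := by
      ext ω
      simp only [hE, B1, Set.mem_iInter, Set.mem_ofPred_eq, Set.mem_preimage]
    have hD' : D = (fun ω (q : F2) => G q.1.1 q.1.2 ω) ⁻¹' B2 := rfl
    rw [hE', hD']
    exact hI.measure_inter_preimage_eq_mul _ _ hB1 hB2
  rw [cond_apply hEm, hindep, ← mul_assoc,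
    ENNReal.inv_mul_cancel hEpos (measure_ne_top _ _), one_mul]
  exact hFprob
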